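/- arXiv:1612.03782 — 8 statements merged into one kernel-verified Lean document; each statement's English description precedes it below -/
import Mathlib

section
/- Good *-functors have the right lifting property with respect to trivial cofibrations of *-categories: let i : A ⥤ B be a *-functor that is injective on objects and a unitary equivalence, let f : C ⥤ D be a good *-functor, and let α : A ⥤ C and β : B ⥤ D be *-functors with α ⋙ f = i ⋙ β (equality of functors). Then there exists a *-functor ℓ : B ⥤ C with i ⋙ ℓ = α and ℓ ⋙ f = β. -/
open CategoryTheory

universe v u

/-- A `*`-category: a category with an involution fixing objects. -/
class StarCategoryStruct (C : Type u) [Category.{v} C] : Type (max u v) where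
  star : ∀ {X Y : C}, (X ⟶ Y) → (Y ⟶ X)
  star_star : ∀ {X Y : C} (f : X ⟶ Y), star (star f) = f
  star_id : ∀ X : C, star (𝟙 X) = 𝟙 X
  star_comp : ∀ {X Y Z : C} (f : X ⟶ Y) (g : Y ⟶ Z), star (f ≫ g) = star g ≫ star f

/-- A morphism is unitary if its star is a two-sided inverse. -/
def IsUnitary {C : Type*} [Category C] [StarCategoryStruct C] {X Y : C} (u : X ⟶ Y) : Prop :=
  u ≫ StarCategoryStruct.star u = 𝟙 X ∧ StarCategoryStruct.star u ≫ u = 𝟙 Y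

/-- A functor between `*`-categories is a `*`-functor if it preserves the involution. -/
def IsStarFunctor {C D : Type*} [Category C] [Category D]
    [StarCategoryStruct C] [StarCategoryStruct D] (F : C ⥤ D) : Prop :=
  ∀ {X Y : C} (f : X ⟶ Y),
    F.map (StarCategoryStruct.star f) = StarCategoryStruct.star (F.map f)

/-- A `*`-functor is a unitary equivalence if it admits a `*`-functor inverse up to unitary
natural isomorphisms. -/
def IsUnitaryEquivalence {C D : Type*} [Category C] [Category D]
    [StarCategoryStruct C] [StarCategoryStruct D] (F : C ⥤ D) : Prop :=
  ∃ G : D ⥤ C, IsStarFunctor G ∧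
    ∃ (η : F ⋙ G ≅ 𝟭 C) (ε : G ⋙ F ≅ 𝟭 D),
      (∀ X : C, IsUnitary (η.hom.app X)) ∧ (∀ Y : D, IsUnitary (ε.hom.app Y))

/-- A `*`-functor is good (a unitary isofibration) if unitary morphisms out of an image object
lift along it. -/
def IsGood {C D : Type*} [Category C] [Category D]
    [StarCategoryStruct C] [StarCategoryStruct D] (F : C ⥤ D) : Prop :=
  ∀ (c : C) (d : D) (u : F.obj c ⟶ d), IsUnitary u →
    ∃ (c' : C) (h : F.obj c' = d) (v : c ⟶ c'),
      IsUnitary v ∧ F.map v ≫ eqToHom h = u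

namespace StarCategoryStruct

variable {C : Type*} [Category C] [StarCategoryStruct C]

@[simp]
theorem star_eqToHom {X Y : C} (h : X = Y) : star (eqToHom h) = eqToHom h.symm := by
  subst h
  exact star_id _

end StarCategoryStruct

namespace IsUnitary

variable {C D : Type*} [Category C] [Category D] [StarCategoryStruct C] [StarCategoryStruct D]

theorem eqToHom {X Y : C} (h : X = Y) : IsUnitary (eqToHom h) := by
  simp [IsUnitary]

theorem comp {X Y Z : C} {u : X ⟶ Y} {v : Y ⟶ Z} (hu : IsUnitary u) (hv : IsUnitary v) :
    IsUnitary (u ≫ v) := by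
  constructor
  · rw [StarCategoryStruct.star_comp, Category.assoc, ← Category.assoc v, hv.1,
      Category.id_comp, hu.1]
  · rw [StarCategoryStruct.star_comp, Category.assoc, ← Category.assoc _ u, hu.2,
      Category.id_comp, hv.2]

theorem map {F : C ⥤ D} (hF : IsStarFunctor F) {X Y : C} {u : X ⟶ Y} (hu : IsUnitary u) :
    IsUnitary (F.map u) := by
  simp [IsUnitary, ← hF _, ← F.map_comp, hu.1, hu.2]

theorem star_comp_cancel {X Y Z : C} {u : X ⟶ Y} (hu : IsUnitary u) (g : Y ⟶ Z) :
    StarCategoryStruct.star u ≫ u ≫ g = g := by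
  rw [← Category.assoc, hu.2, Category.id_comp]

theorem comp_star_cancel {X Y Z : C} {u : X ⟶ Y} (hu : IsUnitary u) (g : X ⟶ Z) :
    u ≫ StarCategoryStruct.star u ≫ g = g := by
  rw [← Category.assoc, hu.1, Category.id_comp]

end IsUnitary

theorem IsUnitaryEquivalence.isEquivalence {C D : Type*} [Category C] [Category D]
    [StarCategoryStruct C] [StarCategoryStruct D] {F : C ⥤ D} (hF : IsUnitaryEquivalence F) :
    F.IsEquivalence := by
  obtain ⟨G, -, η, ε, -, -⟩ := hF
  exact .mk' G η.symm ε

theorem IsUnitaryEquivalence.exists_isUnitary {C D : Type*} [Category C] [Category D]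
    [StarCategoryStruct C] [StarCategoryStruct D] {F : C ⥤ D} (hF : IsUnitaryEquivalence F)
    (Y : D) : ∃ (X : C) (u : F.obj X ⟶ Y), IsUnitary u := by
  obtain ⟨G, -, -, ε, -, hε⟩ := hF
  exact ⟨G.obj Y, ε.hom.app Y, hε Y⟩

/-- In a lifting problem of a trivial cofibration against a good `*`-functor, each object `b` is
unitarily isomorphic to some `i.obj a`, and the isomorphism lifts to one out of `α.obj a`; both are
identities if `b` is in the image of `i`. -/
theorem IsGood.exists_lift_obj {A B C D : Type*} [Category A] [Category B] [Category C]
    [Category D] [StarCategoryStruct A] [StarCategoryStruct B] [StarCategoryStruct C]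
    [StarCategoryStruct D] {i : A ⥤ B} (hiinj : Function.Injective i.obj)
    (hiequiv : IsUnitaryEquivalence i) {f : C ⥤ D} (hfgood : IsGood f) {α : A ⥤ C} {β : B ⥤ D}
    (hβ : IsStarFunctor β) (hsq : α ⋙ f = i ⋙ β) (b : B) :
    ∃ (a : A) (w : i.obj a ⟶ b) (c : C) (h : f.obj c = β.obj b) (v : α.obj a ⟶ c),
      IsUnitary w ∧ IsUnitary v ∧
      f.map v = eqToHom (Functor.congr_obj hsq a) ≫ β.map w ≫ eqToHom h.symm ∧
      ∀ (a' : A) (hb : i.obj a' = b), ∃ (e : a = a') (e' : c = α.obj a'),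
        w = eqToHom ((congrArg i.obj e).trans hb) ∧
        v = eqToHom ((congrArg α.obj e).trans e'.symm) := by
  by_cases hb : ∃ a, i.obj a = b
  · obtain ⟨a, rfl⟩ := hb
    refine ⟨a, 𝟙 _, α.obj a, Functor.congr_obj hsq a, 𝟙 _, .eqToHom rfl, .eqToHom rfl, by simp, ?_⟩
    intro a' ha'
    obtain rfl := hiinj ha'
    exact ⟨rfl, rfl, rfl, rfl⟩
  · obtain ⟨a, w, hw⟩ := hiequiv.exists_isUnitary b
    obtain ⟨c, h, v, hv, hvw⟩ := hfgood (α.obj a) (β.obj b)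
      (eqToHom (Functor.congr_obj hsq a) ≫ β.map w) ((IsUnitary.eqToHom _).comp (hw.map hβ))
    refine ⟨a, w, c, h, v, hw, hv, ?_, fun a' ha' => absurd ⟨a', ha'⟩ hb⟩
    rw [← Category.assoc, ← hvw]
    simp

/-- Good `*`-functors have the right lifting property with respect to trivial cofibrations. -/
theorem good_rlp_trivialCofibration
    {A B C D : Type*} [Category A] [Category B] [Category C] [Category D]
    [StarCategoryStruct A] [StarCategoryStruct B]
    [StarCategoryStruct C] [StarCategoryStruct D]
    (i : A ⥤ B) (hi : IsStarFunctor i)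
    (hiinj : Function.Injective i.obj) (hiequiv : IsUnitaryEquivalence i)
    (f : C ⥤ D) (hf : IsStarFunctor f) (hfgood : IsGood f)
    (α : A ⥤ C) (hα : IsStarFunctor α) (β : B ⥤ D) (hβ : IsStarFunctor β)
    (hsq : α ⋙ f = i ⋙ β) :
    ∃ ℓ : B ⥤ C, IsStarFunctor ℓ ∧ i ⋙ ℓ = α ∧ ℓ ⋙ f = β := by
  have := hiequiv.isEquivalence
  choose r w c h v hw hv hvw him using IsGood.exists_lift_obj hiinj hiequiv hfgood hβ hsq
  let ℓ : B ⥤ C :=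
    { obj := c
      map := fun {b b'} g => StarCategoryStruct.star (v b) ≫
        α.map (i.preimage (w b ≫ g ≫ StarCategoryStruct.star (w b'))) ≫ v b'
      map_id := fun b => by
        simp [(hw b).1, (hv b).2]
      map_comp := fun {b b' b''} g g' => by
        have : i.preimage (w b ≫ (g ≫ g') ≫ StarCategoryStruct.star (w b'')) =
            i.preimage (w b ≫ g ≫ StarCategoryStruct.star (w b')) ≫
              i.preimage (w b' ≫ g' ≫ StarCategoryStruct.star (w b'')) :=
          i.map_injective (by simp [(hw b').star_comp_cancel])
        rw [this]
        simp [(hv b').comp_star_cancel] }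
  refine ⟨ℓ, fun {b b'} g => ?_, ?_, ?_⟩
  · have : i.preimage (w b' ≫ StarCategoryStruct.star g ≫ StarCategoryStruct.star (w b)) =
        StarCategoryStruct.star (i.preimage (w b ≫ g ≫ StarCategoryStruct.star (w b'))) :=
      i.map_injective (by
        simp [hi _, StarCategoryStruct.star_comp, StarCategoryStruct.star_star])
    simp [ℓ, this, hα _, StarCategoryStruct.star_comp, StarCategoryStruct.star_star]
  · refine CategoryTheory.Functor.ext (fun a => (him (i.obj a) a rfl).2.1) fun a a' g => ?_
    obtain ⟨e, e', hwa, hva⟩ := him (i.obj a) a rfl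
    obtain ⟨d, d', hwa', hva'⟩ := him (i.obj a') a' rfl
    have : i.preimage (w (i.obj a) ≫ i.map g ≫ StarCategoryStruct.star (w (i.obj a'))) =
        eqToHom e ≫ g ≫ eqToHom d.symm :=
      i.map_injective (by simp [hwa, hwa', eqToHom_map])
    simp [ℓ, this, hva, hva', eqToHom_map]
  · refine CategoryTheory.Functor.ext h fun b b' g => ?_
    have hαf {a a' : A} (p : a ⟶ a') : f.map (α.map p) =
        eqToHom (Functor.congr_obj hsq a) ≫ β.map (i.map p) ≫
          eqToHom (Functor.congr_obj hsq a').symm :=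
      Functor.congr_hom hsq p
    simp only [ℓ, Functor.comp_map, Functor.map_comp, hf _, hvw, hαf, Functor.map_preimage,
      StarCategoryStruct.star_comp, StarCategoryStruct.star_eqToHom, hβ _, Category.assoc,
      eqToHom_trans_assoc, eqToHom_refl, Category.id_comp, ((hw _).map hβ).star_comp_cancel]
end

section
/- *-functors injective on objects have the left lifting property with respect to good unitary equivalences: let i : A ⥤ B be a *-functor that is injective on objects, let f : C ⥤ D be a good *-functor that is a unitary equivalence, and let α : A ⥤ C and β : B ⥤ D be *-functors with α ⋙ f = i ⋙ β (equality of functors). Then there exists a *-functor ℓ : B ⥤ C with i ⋙ ℓ = α and ℓ ⋙ f = β. -/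
open CategoryTheory

universe v u

theorem star_eqToHom {C : Type*} [Category C] [StarCategoryStruct C] {X Y : C} (h : X = Y) :
    StarCategoryStruct.star (eqToHom h) = eqToHom h.symm := by
  subst h
  exact StarCategoryStruct.star_id X

theorem IsGood.surjective_obj {C D : Type*} [Category C] [Category D]
    [StarCategoryStruct C] [StarCategoryStruct D] {F : C ⥤ D} (hF : IsGood F)
    (hequiv : IsUnitaryEquivalence F) : Function.Surjective F.obj := by
  obtain ⟨G, -, -, ε, -, hε⟩ := hequiv
  intro d
  obtain ⟨c, h, -⟩ := hF (G.obj d) d (ε.hom.app d) (hε d)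
  exact ⟨c, h⟩

/-- The lift of a functor `β` along a fully faithful functor `f`, given a lift of `β` on objects. -/
noncomputable def liftOfObj {B C D : Type*} [Category B] [Category C] [Category D]
    (f : C ⥤ D) [f.Full] [f.Faithful] (β : B ⥤ D) (L : B → C)
    (hL : ∀ b, f.obj (L b) = β.obj b) : B ⥤ C where
  obj := L
  map {X Y} g := f.preimage (eqToHom (hL X) ≫ β.map g ≫ eqToHom (hL Y).symm)
  map_id X := f.map_injective (by simp)
  map_comp g h := f.map_injective (by simp)

theorem liftOfObj_comp {B C D : Type*} [Category B] [Category C] [Category D]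
    (f : C ⥤ D) [f.Full] [f.Faithful] (β : B ⥤ D) (L : B → C)
    (hL : ∀ b, f.obj (L b) = β.obj b) : liftOfObj f β L hL ⋙ f = β :=
  CategoryTheory.Functor.ext hL fun X Y g => by simp [liftOfObj]

theorem isStarFunctor_liftOfObj {B C D : Type*} [Category B] [Category C] [Category D]
    [StarCategoryStruct B] [StarCategoryStruct C] [StarCategoryStruct D]
    (f : C ⥤ D) [f.Full] [f.Faithful] (hf : IsStarFunctor f) (β : B ⥤ D) (hβ : IsStarFunctor β)
    (L : B → C) (hL : ∀ b, f.obj (L b) = β.obj b) : IsStarFunctor (liftOfObj f β L hL) := by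
  intro X Y g
  apply f.map_injective
  rw [hf]
  simp [liftOfObj, hβ g, StarCategoryStruct.star_comp, star_eqToHom]

/-- Functors agreeing on objects are equal if they become equal after composition with a faithful
functor. -/
theorem functor_eq_of_comp_faithful_eq {A C D : Type*} [Category A] [Category C] [Category D]
    {F G : A ⥤ C} (f : C ⥤ D) [f.Faithful] (hobj : ∀ a, F.obj a = G.obj a)
    (h : F ⋙ f = G ⋙ f) : F = G :=
  CategoryTheory.Functor.ext hobj fun X Y g => f.map_injective (by
    simpa [eqToHom_map] using Functor.congr_hom h g)

/-- `*`-functors injective on objects have the left lifting property with respect to good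
unitary equivalences. -/
theorem cofibration_llp_trivialFibration
    {A B C D : Type*} [Category A] [Category B] [Category C] [Category D]
    [StarCategoryStruct A] [StarCategoryStruct B]
    [StarCategoryStruct C] [StarCategoryStruct D]
    (i : A ⥤ B) (hi : IsStarFunctor i) (hiinj : Function.Injective i.obj)
    (f : C ⥤ D) (hf : IsStarFunctor f)
    (hfgood : IsGood f) (hfequiv : IsUnitaryEquivalence f)
    (α : A ⥤ C) (hα : IsStarFunctor α) (β : B ⥤ D) (hβ : IsStarFunctor β)
    (hsq : α ⋙ f = i ⋙ β) :
    ∃ ℓ : B ⥤ C, IsStarFunctor ℓ ∧ i ⋙ ℓ = α ∧ ℓ ⋙ f = β := by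
  have := hfequiv.isEquivalence
  have hobj : ∀ b, ∃ c, f.obj c = β.obj b ∧ ∀ a, i.obj a = b → c = α.obj a := by
    intro b
    by_cases hb : ∃ a, i.obj a = b
    · obtain ⟨a, rfl⟩ := hb
      exact ⟨α.obj a, Functor.congr_obj hsq a, fun a' h => by rw [hiinj h]⟩
    · obtain ⟨c, hc⟩ := hfgood.surjective_obj hfequiv (β.obj b)
      exact ⟨c, hc, fun a h => (hb ⟨a, h⟩).elim⟩
  choose L hL hLα using hobj
  refine ⟨liftOfObj f β L hL, isStarFunctor_liftOfObj f hf β hβ L hL, ?_,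
    liftOfObj_comp f β L hL⟩
  refine functor_eq_of_comp_faithful_eq f (fun a => hLα _ a rfl) ?_
  rw [Functor.assoc, liftOfObj_comp, hsq]
end

section
/- Every *-functor a : A ⥤ B between small *-categories factors as a cofibration followed by a trivial fibration: there exist a small *-category Z, a *-functor j : A ⥤ Z that is injective on objects, and a *-functor q : Z ⥤ B that is good and a unitary equivalence, such that j ⋙ q = a (equality of functors). -/
open CategoryTheory

universe v u

/-- A bundled small `*`-category. -/
structure StarCat : Type (u + 1) where
  carrier : Type u
  [cat : SmallCategory carrier]
  [str : StarCategoryStruct carrier]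

attribute [instance] StarCat.cat StarCat.str

instance : CoeSort StarCat.{u} (Type u) :=
  ⟨StarCat.carrier⟩

theorem isStarFunctor_id {C : Type*} [Category C] [StarCategoryStruct C] :
    IsStarFunctor (𝟭 C) := fun _ => rfl

theorem IsStarFunctor.comp {C D E : Type*} [Category C] [Category D] [Category E]
    [StarCategoryStruct C] [StarCategoryStruct D] [StarCategoryStruct E]
    {F : C ⥤ D} {G : D ⥤ E} (hF : IsStarFunctor F) (hG : IsStarFunctor G) :
    IsStarFunctor (F ⋙ G) := by
  intro X Y f
  show G.map (F.map _) = _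
  rw [hF f, hG]
  rfl

/-- The category of small `*`-categories and `*`-functors. -/
instance : Category StarCat.{u} where
  Hom A B := { F : A.carrier ⥤ B.carrier // IsStarFunctor F }
  id A := ⟨𝟭 A.carrier, isStarFunctor_id⟩
  comp F G := ⟨F.1 ⋙ G.1, IsStarFunctor.comp F.2 G.2⟩
  id_comp F := Subtype.ext (Functor.id_comp F.1)
  comp_id F := Subtype.ext (Functor.comp_id F.1)
  assoc F G H := Subtype.ext (Functor.assoc F.1 G.1 H.1)

/-- The objects of the source and of the target of a functor `a`, with morphisms computed in the
target. -/
def MappingCylinder {A B : Type*} [Category A] [Category B] (_ : A ⥤ B) := A ⊕ B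

namespace MappingCylinder

section

variable {A B : Type*} [Category A] [Category B] (a : A ⥤ B)

/-- The object of the target underlying an object of the mapping cylinder. -/
def base (x : MappingCylinder a) : B := Sum.elim a.obj id x

instance : Category (MappingCylinder a) where
  Hom x y := base a x ⟶ base a y
  id x := 𝟙 (base a x)
  comp f g := CategoryStruct.comp (obj := B) f g
  id_comp f := Category.id_comp (obj := B) f
  comp_id f := Category.comp_id (obj := B) f
  assoc f g h := Category.assoc (obj := B) f g h

instance [StarCategoryStruct B] : StarCategoryStruct (MappingCylinder a) where
  star f := StarCategoryStruct.star (C := B) f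
  star_star f := StarCategoryStruct.star_star (C := B) f
  star_id x := StarCategoryStruct.star_id (base a x)
  star_comp f g := StarCategoryStruct.star_comp (C := B) f g

/-- The inclusion of the source. -/
def inl : A ⥤ MappingCylinder a where
  obj x := Sum.inl x
  map f := a.map f
  map_id x := a.map_id x
  map_comp f g := a.map_comp f g

/-- The inclusion of the target. -/
def inr : B ⥤ MappingCylinder a where
  obj y := Sum.inr y
  map f := f

/-- The projection to the target. -/
def proj : MappingCylinder a ⥤ B where
  obj x := base a x
  map f := f

/-- The projection followed by the inclusion of the target is isomorphic to the identity. -/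
def projInrIso : proj a ⋙ inr a ≅ 𝟭 (MappingCylinder a) where
  hom :=
    { app := fun x => 𝟙 (base a x)
      naturality := fun _ _ f =>
        (Category.comp_id (obj := B) f).trans (Category.id_comp (obj := B) f).symm }
  inv :=
    { app := fun x => 𝟙 (base a x)
      naturality := fun _ _ f =>
        (Category.comp_id (obj := B) f).trans (Category.id_comp (obj := B) f).symm }
  hom_inv_id := NatTrans.ext (funext fun x => Category.id_comp (𝟙 (base a x)))
  inv_hom_id := NatTrans.ext (funext fun x => Category.id_comp (𝟙 (base a x)))

theorem inl_obj_injective : Function.Injective (inl a).obj := Sum.inl_injective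

end

end MappingCylinder

theorem isUnitary_id {C : Type*} [Category C] [StarCategoryStruct C] (X : C) :
    IsUnitary (𝟙 X) := by
  simp [IsUnitary, StarCategoryStruct.star_id]

namespace MappingCylinder

section

variable {A B : Type*} [Category A] [Category B] [StarCategoryStruct B] (a : A ⥤ B)

theorem isGood_proj : IsGood (proj a) := fun _ d u hu =>
  ⟨(inr a).obj d, rfl, u, hu, Category.comp_id u⟩

theorem isUnitaryEquivalence_proj : IsUnitaryEquivalence (proj a) :=
  ⟨inr a, fun _ => rfl, projInrIso a, Iso.refl _,
    fun x => isUnitary_id (base a x), fun y => isUnitary_id y⟩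

end

end MappingCylinder

/-- Every `*`-functor between small `*`-categories factors as a cofibration (injective on
objects) followed by a trivial fibration (a good unitary equivalence). -/
theorem factorization_cofibration_trivialFibration
    {A B : Type u} [SmallCategory A] [SmallCategory B]
    [StarCategoryStruct A] [StarCategoryStruct B]
    (a : A ⥤ B) (ha : IsStarFunctor a) :
    ∃ (Z : StarCat.{u}) (j : A ⥤ Z.carrier) (q : Z.carrier ⥤ B),
      IsStarFunctor j ∧ Function.Injective j.obj ∧
      IsStarFunctor q ∧ IsGood q ∧ IsUnitaryEquivalence q ∧
      j ⋙ q = a := by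
  exact ⟨⟨MappingCylinder a⟩, MappingCylinder.inl a, MappingCylinder.proj a, fun f => ha f,
    MappingCylinder.inl_obj_injective a, fun _ => rfl, MappingCylinder.isGood_proj a,
    MappingCylinder.isUnitaryEquivalence_proj a, rfl⟩
end

section
/- Characterization of marked equivalences: let (C, M) and (D, N) be marked *-categories and F : C ⥤ D a marked *-functor. Then F is a marked equivalence if and only if the following three conditions hold: (1) F is an equivalence of the underlying categories; (2) for every object d of D there exist an object c of C and a marked morphism u : F.obj c ⟶ d; (3) for all objects c, c' of C, every marked morphism w : F.obj c ⟶ F.obj c' is of the form F.map v for some marked morphism v : c ⟶ c'. (Conditions (2) and (3), together with faithfulness of F, say that the induced functor on the wide subcategories of marked morphisms is an equivalence.) -/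
open CategoryTheory

universe v u

/-- A marking on a `*`-category: a class of unitary morphisms containing identities, closed
under composition and the involution. -/
structure IsMarking {C : Type*} [Category C] [StarCategoryStruct C]
    (M : MorphismProperty C) : Prop where
  id_mem : ∀ X : C, M (𝟙 X)
  comp_mem : ∀ {X Y Z : C} (f : X ⟶ Y) (g : Y ⟶ Z), M f → M g → M (f ≫ g)
  star_mem : ∀ {X Y : C} (f : X ⟶ Y), M f → M (StarCategoryStruct.star f)
  unitary_of_mem : ∀ {X Y : C} (f : X ⟶ Y), M f → IsUnitary f

/-- A marked `*`-functor between marked `*`-categories. -/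
def IsMarkedFunctor {C D : Type*} [Category C] [Category D]
    [StarCategoryStruct C] [StarCategoryStruct D]
    (M : MorphismProperty C) (N : MorphismProperty D) (F : C ⥤ D) : Prop :=
  IsStarFunctor F ∧ ∀ {X Y : C} (f : X ⟶ Y), M f → N (F.map f)

/-- A marked `*`-functor is a marked equivalence if it admits a marked `*`-functor inverse up to
natural isomorphisms all of whose components are marked. -/
def IsMarkedEquivalence {C D : Type*} [Category C] [Category D]
    [StarCategoryStruct C] [StarCategoryStruct D]
    (M : MorphismProperty C) (N : MorphismProperty D) (F : C ⥤ D) : Prop :=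
  ∃ G : D ⥤ C, IsMarkedFunctor N M G ∧
    ∃ (η : F ⋙ G ≅ 𝟭 C) (ε : G ⋙ F ≅ 𝟭 D),
      (∀ X : C, M (η.hom.app X)) ∧ (∀ Y : D, N (ε.hom.app Y))

namespace IsUnitary

variable {C : Type*} [Category C] [StarCategoryStruct C]

/-- The isomorphism underlying a unitary morphism. -/
def toIso {X Y : C} {u : X ⟶ Y} (hu : IsUnitary u) : X ≅ Y where
  hom := u
  inv := StarCategoryStruct.star u
  hom_inv_id := hu.1
  inv_hom_id := hu.2

lemma comp_star_comp_self {W X Y Z : C} {u : X ⟶ Y} (hu : IsUnitary u) (f : W ⟶ Z) (g : Z ⟶ Y) :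
    (f ≫ g ≫ StarCategoryStruct.star u) ≫ u = f ≫ g := by
  simp [hu.2]

end IsUnitary

lemma StarCategoryStruct.star_comp_comp_star {C : Type*} [Category C] [StarCategoryStruct C]
    {W X Y Z : C} (f : W ⟶ X) (g : X ⟶ Y) (h : Z ⟶ Y) :
    star (f ≫ g ≫ star h) = h ≫ star g ≫ star f := by
  simp [star_comp, StarCategoryStruct.star_star]

section UnitaryInverse

open StarCategoryStruct

universe v₁ v₂ u₁ u₂

variable {C : Type u₁} {D : Type u₂} [Category.{v₁} C] [Category.{v₂} D] [StarCategoryStruct D]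
  (F : C ⥤ D) [F.Full] [F.Faithful] (c : D → C) (u : ∀ d, F.obj (c d) ⟶ d)
  (hu : ∀ d, IsUnitary (u d))

/-- The quasi-inverse of a fully faithful functor `F` determined by unitary morphisms
`u d : F.obj (c d) ⟶ d`. -/
noncomputable def unitaryInverse (hu : ∀ d, IsUnitary (u d)) : D ⥤ C where
  obj := c
  map {d d'} f := F.preimage (u d ≫ f ≫ star (u d'))
  map_id d := F.map_injective (by simp [(hu d).1])
  map_comp {_ d' _} f g := F.map_injective (by
    simp [reassoc_of% (hu d').2])

lemma map_unitaryInverse_map {d d' : D} (f : d ⟶ d') :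
    F.map ((unitaryInverse F c u hu).map f) = u d ≫ f ≫ star (u d') :=
  F.map_preimage _

/-- The counit of `unitaryInverse`, with components `u d`. -/
noncomputable def unitaryInverseCounit : unitaryInverse F c u hu ⋙ F ≅ 𝟭 D :=
  NatIso.ofComponents (fun d => (hu d).toIso) (fun {d d'} f => by
    change F.map ((unitaryInverse F c u hu).map f) ≫ u d' = u d ≫ f
    rw [map_unitaryInverse_map]
    exact (hu d').comp_star_comp_self _ _)

/-- The inverse unit of `unitaryInverse`, with components the `F`-preimages of `u (F.obj X)`. -/
noncomputable def unitaryInverseUnit : F ⋙ unitaryInverse F c u hu ≅ 𝟭 C :=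
  NatIso.ofComponents (fun X => F.preimageIso (hu (F.obj X)).toIso) (fun {X Y} f => by
    apply F.map_injective
    have hX : F.map (F.preimage (u (F.obj X)) ≫ f) = u (F.obj X) ≫ F.map f := by simp
    refine (F.map_comp _ _).trans (Eq.trans ?_ hX.symm)
    exact (congrArg₂ (· ≫ ·) (map_unitaryInverse_map F c u hu _) (F.map_preimage _)).trans
      ((hu (F.obj Y)).comp_star_comp_self _ _))

lemma map_unitaryInverseUnit_hom_app (X : C) :
    F.map ((unitaryInverseUnit F c u hu).hom.app X) = u (F.obj X) :=
  F.map_preimage _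

lemma isStarFunctor_unitaryInverse [StarCategoryStruct C] (hF : IsStarFunctor F) :
    IsStarFunctor (unitaryInverse F c u hu) := by
  intro d d' f
  apply F.map_injective
  rw [hF, map_unitaryInverse_map, map_unitaryInverse_map]
  exact (star_comp_comp_star _ _ _).symm

end UnitaryInverse

/-- Characterization of marked equivalences of marked `*`-categories. -/
theorem isMarkedEquivalence_iff {C D : Type*} [Category C] [Category D]
    [StarCategoryStruct C] [StarCategoryStruct D]
    (M : MorphismProperty C) (N : MorphismProperty D)
    (hM : IsMarking M) (hN : IsMarking N)
    (F : C ⥤ D) (hF : IsMarkedFunctor M N F) :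
    IsMarkedEquivalence M N F ↔
      (F.IsEquivalence ∧
       (∀ d : D, ∃ (c : C) (u : F.obj c ⟶ d), N u) ∧
       (∀ (c c' : C) (w : F.obj c ⟶ F.obj c'), N w →
          ∃ v : c ⟶ c', M v ∧ F.map v = w)) := by
  constructor
  · rintro ⟨G, hG, η, ε, hη, hε⟩
    have : F.IsEquivalence := Functor.IsEquivalence.mk' G η.symm ε
    have : G.IsEquivalence := Functor.IsEquivalence.mk' F ε.symm η
    refine ⟨‹_›, fun d => ⟨G.obj d, ε.hom.app d, hε d⟩, fun c c' w hw => ?_⟩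
    refine ⟨StarCategoryStruct.star (η.hom.app c) ≫ G.map w ≫ η.hom.app c',
      hM.comp_mem _ _ (hM.star_mem _ (hη c)) (hM.comp_mem _ _ (hG.2 w hw) (hη c')), ?_⟩
    apply G.map_injective
    rw [← cancel_mono (η.hom.app c')]
    refine (η.hom.naturality _).trans ?_
    have h := (hM.unitary_of_mem _ (hη c)).1
    simp only [Functor.id_map]
    rw [reassoc_of% h]
  · rintro ⟨_, hsurj, hlift⟩
    choose c u hu using hsurj
    have hu' (d : D) : IsUnitary (u d) := hN.unitary_of_mem _ (hu d)
    have mem_of_map {X Y : C} (f : X ⟶ Y) (hf : N (F.map f)) : M f := by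
      obtain ⟨v, hv, hvf⟩ := hlift _ _ _ hf
      rwa [← F.map_injective hvf]
    refine ⟨unitaryInverse F c u hu', ⟨isStarFunctor_unitaryInverse F c u hu' hF.1, ?_⟩,
      unitaryInverseUnit F c u hu', unitaryInverseCounit F c u hu', fun X => ?_, hu⟩
    · intro d d' f hf
      apply mem_of_map
      rw [map_unitaryInverse_map]
      exact hN.comp_mem _ _ (hu d) (hN.comp_mem _ _ hf (hN.star_mem _ (hu d')))
    · apply mem_of_map
      rw [map_unitaryInverseUnit_hom_app]
      exact hu (F.obj X)
end

section
/- The category of small ℂ-linear *-categories and ℂ-linear *-functors has all small limits and all small colimits (it is complete and cocomplete). -/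
open CategoryTheory

universe v u

open scoped ComplexConjugate

/-- A `ℂ`-linear `*`-category: a preadditive `ℂ`-linear category with an involution that is
additive and conjugate-linear. -/
class StarLinearCategory (C : Type u) [Category.{v} C] [Preadditive C] [Linear ℂ C] extends
    StarCategoryStruct C where
  star_add : ∀ {X Y : C} (f g : X ⟶ Y), star (f + g) = star f + star g
  star_smul : ∀ {X Y : C} (a : ℂ) (f : X ⟶ Y), star (a • f) = conj a • star f

/-- A `ℂ`-linear `*`-functor: a `*`-functor that is additive and `ℂ`-linear on hom-spaces. -/
def IsLinearStarFunctor {C D : Type*} [Category C] [Category D]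
    [Preadditive C] [Preadditive D] [Linear ℂ C] [Linear ℂ D]
    [StarLinearCategory C] [StarLinearCategory D] (F : C ⥤ D) : Prop :=
  IsStarFunctor F ∧
    (∀ {X Y : C} (f g : X ⟶ Y), F.map (f + g) = F.map f + F.map g) ∧
    (∀ {X Y : C} (a : ℂ) (f : X ⟶ Y), F.map (a • f) = a • F.map f)

theorem isLinearStarFunctor_id {C : Type*} [Category C] [Preadditive C] [Linear ℂ C]
    [StarLinearCategory C] : IsLinearStarFunctor (𝟭 C) :=
  ⟨fun _ => rfl, fun _ _ => rfl, fun _ _ => rfl⟩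

theorem IsLinearStarFunctor.comp {C D E : Type*} [Category C] [Category D] [Category E]
    [Preadditive C] [Preadditive D] [Preadditive E]
    [Linear ℂ C] [Linear ℂ D] [Linear ℂ E]
    [StarLinearCategory C] [StarLinearCategory D] [StarLinearCategory E]
    {F : C ⥤ D} {G : D ⥤ E} (hF : IsLinearStarFunctor F) (hG : IsLinearStarFunctor G) :
    IsLinearStarFunctor (F ⋙ G) := by
  refine ⟨?_, ?_, ?_⟩
  · intro X Y f
    show G.map (F.map _) = _
    rw [hF.1 f, hG.1]
    rfl
  · intro X Y f g
    show G.map (F.map _) = _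
    rw [hF.2.1 f g, hG.2.1]
    rfl
  · intro X Y a f
    show G.map (F.map _) = _
    rw [hF.2.2 a f, hG.2.2]
    rfl

/-- A bundled small `ℂ`-linear `*`-category. -/
structure CLinStarCat : Type (u + 1) where
  carrier : Type u
  [cat : SmallCategory carrier]
  [preadd : Preadditive carrier]
  [lin : Linear ℂ carrier]
  [str : StarLinearCategory carrier]

attribute [instance] CLinStarCat.cat CLinStarCat.preadd CLinStarCat.lin CLinStarCat.str

/-- The category of small `ℂ`-linear `*`-categories and `ℂ`-linear `*`-functors. -/
instance : Category CLinStarCat.{u} where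
  Hom A B := { F : A.carrier ⥤ B.carrier // IsLinearStarFunctor F }
  id A := ⟨𝟭 A.carrier, isLinearStarFunctor_id⟩
  comp F G := ⟨F.1 ⋙ G.1, IsLinearStarFunctor.comp F.2 G.2⟩
  id_comp F := Subtype.ext (Functor.id_comp F.1)
  comp_id F := Subtype.ext (Functor.comp_id F.1)
  assoc F G H := Subtype.ext (Functor.assoc F.1 G.1 H.1)

namespace CategoryTheory

section HEq

variable {C : Type*} [Category C]

theorem heq_id {X X' : C} (hX : X = X') : 𝟙 X ≍ 𝟙 X' := by
  subst hX; rfl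

theorem heq_comp_of_heq {X Y Z X' Y' Z' : C} (hX : X = X') (hY : Y = Y') (hZ : Z = Z')
    {f : X ⟶ Y} {f' : X' ⟶ Y'} {g : Y ⟶ Z} {g' : Y' ⟶ Z'} (hf : f ≍ f') (hg : g ≍ g') :
    f ≫ g ≍ f' ≫ g' := by
  subst hX hY hZ hf hg; rfl

theorem heq_zero [Preadditive C] {X Y X' Y' : C} (hX : X = X') (hY : Y = Y') :
    (0 : X ⟶ Y) ≍ (0 : X' ⟶ Y') := by
  subst hX hY; rfl

theorem heq_add [Preadditive C] {X Y X' Y' : C} (hX : X = X') (hY : Y = Y')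
    {f g : X ⟶ Y} {f' g' : X' ⟶ Y'} (hf : f ≍ f') (hg : g ≍ g') : f + g ≍ f' + g' := by
  subst hX hY hf hg; rfl

theorem heq_smul [Preadditive C] [Linear ℂ C] {X Y X' Y' : C} (hX : X = X') (hY : Y = Y')
    (a : ℂ) {f : X ⟶ Y} {f' : X' ⟶ Y'} (hf : f ≍ f') : a • f ≍ a • f' := by
  subst hX hY hf; rfl

theorem heq_star [StarCategoryStruct C] {X Y X' Y' : C} (hX : X = X') (hY : Y = Y')
    {f : X ⟶ Y} {f' : X' ⟶ Y'} (hf : f ≍ f') :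
    StarCategoryStruct.star f ≍ StarCategoryStruct.star f' := by
  subst hX hY hf; rfl

theorem Functor.map_heq_of_eq {D : Type*} [Category D] {P Q : C ⥤ D} (h : P = Q) {X Y : C}
    (f : X ⟶ Y) : P.map f ≍ Q.map f := by
  subst h; rfl

end HEq

end CategoryTheory

namespace CLinStarCat

open CategoryTheory.Limits StarCategoryStruct

/-- The functor underlying a morphism of `CLinStarCat`. -/
def toFunctor {A B : CLinStarCat.{u}} (f : A ⟶ B) : A.carrier ⥤ B.carrier :=
  Subtype.val f

section ToFunctor

variable {A B C : CLinStarCat.{u}}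

/-- A `ℂ`-linear `*`-functor as a morphism of `CLinStarCat`. -/
def ofFunctor (P : A.carrier ⥤ B.carrier) (hP : IsLinearStarFunctor P) : A ⟶ B :=
  ⟨P, hP⟩

theorem hom_ext {f g : A ⟶ B} (h : toFunctor f = toFunctor g) : f = g :=
  Subtype.ext h

theorem toFunctor_comp (f : A ⟶ B) (g : B ⟶ C) :
    toFunctor (f ≫ g) = toFunctor f ⋙ toFunctor g := rfl

theorem map_star (f : A ⟶ B) {X Y : A.carrier} (a : X ⟶ Y) :
    (toFunctor f).map (star a) = star ((toFunctor f).map a) :=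
  f.property.1 a

theorem map_add (f : A ⟶ B) {X Y : A.carrier} (a b : X ⟶ Y) :
    (toFunctor f).map (a + b) = (toFunctor f).map a + (toFunctor f).map b :=
  f.property.2.1 a b

theorem map_smul (f : A ⟶ B) {X Y : A.carrier} (c : ℂ) (a : X ⟶ Y) :
    (toFunctor f).map (c • a) = c • (toFunctor f).map a :=
  f.property.2.2 c a

theorem map_zero (f : A ⟶ B) (X Y : A.carrier) :
    (toFunctor f).map (0 : X ⟶ Y) = 0 := by
  rw [← zero_smul ℂ (0 : X ⟶ Y), map_smul, zero_smul]

end ToFunctor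

variable {J : Type u} [SmallCategory J] (F : J ⥤ CLinStarCat.{u})

/-- The objects of the limit of `F`: compatible families of objects. -/
structure LimitObj where
  /-- The components of the family. -/
  obj : ∀ j, (F.obj j).carrier
  map_obj : ∀ {i j : J} (f : i ⟶ j), (toFunctor (F.map f)).obj (obj i) = obj j

namespace LimitObj

variable {F}

@[ext]
theorem ext {x y : LimitObj F} (h : ∀ j, x.obj j = y.obj j) : x = y := by
  cases x; cases y
  congr
  exact funext h

/-- The morphisms of the limit of `F`: compatible families of morphisms. -/
def homs (x y : LimitObj F) : Submodule ℂ (∀ j, x.obj j ⟶ y.obj j) where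
  carrier := {a | ∀ ⦃i j : J⦄ (f : i ⟶ j), (toFunctor (F.map f)).map (a i) ≍ a j}
  add_mem' ha hb i j f := by
    rw [Pi.add_apply, map_add]
    exact heq_add (x.map_obj f) (y.map_obj f) (ha f) (hb f)
  zero_mem' i j f := by
    rw [Pi.zero_apply, map_zero]
    exact heq_zero (x.map_obj f) (y.map_obj f)
  smul_mem' c a ha i j f := by
    rw [Pi.smul_apply, map_smul]
    exact heq_smul (x.map_obj f) (y.map_obj f) c (ha f)

instance : SmallCategory (LimitObj F) where
  Hom x y := homs x y
  id x := ⟨fun j => 𝟙 (x.obj j), fun i j f => by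
    rw [CategoryTheory.Functor.map_id]
    exact heq_id (x.map_obj f)⟩
  comp {x y z} a b := ⟨fun j => a.1 j ≫ b.1 j, fun i j f => by
    rw [Functor.map_comp]
    exact heq_comp_of_heq (x.map_obj f) (y.map_obj f) (z.map_obj f) (a.2 f) (b.2 f)⟩
  id_comp a := Subtype.ext (funext fun j => Category.id_comp (a.1 j))
  comp_id a := Subtype.ext (funext fun j => Category.comp_id (a.1 j))
  assoc a b c := Subtype.ext (funext fun j => Category.assoc (a.1 j) (b.1 j) (c.1 j))

instance : Preadditive (LimitObj F) where
  homGroup x y := inferInstanceAs (AddCommGroup (homs x y))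
  add_comp _ _ _ a b c :=
    Subtype.ext (funext fun j => Preadditive.add_comp _ _ _ (a.1 j) (b.1 j) (c.1 j))
  comp_add _ _ _ a b c :=
    Subtype.ext (funext fun j => Preadditive.comp_add _ _ _ (a.1 j) (b.1 j) (c.1 j))

instance : Linear ℂ (LimitObj F) where
  homModule x y := inferInstanceAs (Module ℂ (homs x y))
  smul_comp _ _ _ r a b :=
    Subtype.ext (funext fun j => Linear.smul_comp _ _ _ r (a.1 j) (b.1 j))
  comp_smul _ _ _ a r b :=
    Subtype.ext (funext fun j => Linear.comp_smul _ _ _ (a.1 j) r (b.1 j))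

instance : StarLinearCategory (LimitObj F) where
  star {x y} a := ⟨fun j => star (a.1 j), fun i j f => by
    rw [map_star]
    exact heq_star (x.map_obj f) (y.map_obj f) (a.2 f)⟩
  star_star a := Subtype.ext (funext fun j => star_star (a.1 j))
  star_id x := Subtype.ext (funext fun j => star_id (x.obj j))
  star_comp a b := Subtype.ext (funext fun j => star_comp (a.1 j) (b.1 j))
  star_add a b := Subtype.ext (funext fun j => StarLinearCategory.star_add (a.1 j) (b.1 j))
  star_smul r a := Subtype.ext (funext fun j => StarLinearCategory.star_smul r (a.1 j))

theorem hom_heq {x y x' y' : LimitObj F} (hx : x = x') (hy : y = y') {a : x ⟶ y} {b : x' ⟶ y'}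
    (h : ∀ j, a.1 j ≍ b.1 j) : a ≍ b := by
  subst hx hy
  exact heq_of_eq (Subtype.ext (funext fun j => eq_of_heq (h j)))

end LimitObj

/-- The limit cone of `F`. -/
def limitCone : Cone F where
  pt := ⟨LimitObj F⟩
  π :=
    { app j := ofFunctor (A := ⟨LimitObj F⟩)
        { obj x := x.obj j
          map a := a.1 j
          map_id _ := rfl
          map_comp _ _ := rfl } ⟨fun _ => rfl, fun _ _ => rfl, fun _ _ => rfl⟩
      naturality _ _ f := hom_ext <| Functor.hext (fun x => (x.map_obj f).symm)
        fun _ _ a => (a.2 f).symm }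

theorem cone_w (s : Cone F) {i j : J} (f : i ⟶ j) :
    toFunctor (s.π.app i) ⋙ toFunctor (F.map f) = toFunctor (s.π.app j) := by
  rw [← toFunctor_comp, s.w]

/-- The cone `limitCone F` is a limit cone. -/
def isLimitLimitCone : IsLimit (limitCone F) where
  lift s := ofFunctor (B := ⟨LimitObj F⟩)
    { obj c := ⟨fun j => (toFunctor (s.π.app j)).obj c,
        fun f => Functor.congr_obj (cone_w F s f) c⟩
      map a := ⟨fun j => (toFunctor (s.π.app j)).map a,
        fun _ _ f => Functor.map_heq_of_eq (cone_w F s f) a⟩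
      map_id c := Subtype.ext (funext fun j => (toFunctor (s.π.app j)).map_id c)
      map_comp a b := Subtype.ext (funext fun j => (toFunctor (s.π.app j)).map_comp a b) }
    ⟨fun a => Subtype.ext (funext fun j => map_star (s.π.app j) a),
      fun a b => Subtype.ext (funext fun j => map_add (s.π.app j) a b),
      fun r a => Subtype.ext (funext fun j => map_smul (s.π.app j) r a)⟩
  fac s j := rfl
  uniq s m hm := by
    have key (j : J) : toFunctor m ⋙ toFunctor ((limitCone F).π.app j) =
        toFunctor (s.π.app j) := by
      rw [← toFunctor_comp, hm]
    have hobj (c : s.pt.carrier) : ((toFunctor m).obj c : LimitObj F) =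
        ⟨fun j => (toFunctor (s.π.app j)).obj c,
          fun f => Functor.congr_obj (cone_w F s f) c⟩ :=
      LimitObj.ext fun j => Functor.congr_obj (key j) c
    exact hom_ext <| Functor.hext hobj fun c d a =>
      LimitObj.hom_heq (hobj c) (hobj d) fun j => Functor.map_heq_of_eq (key j) a

/-- The objects of the colimit of `F`: the colimit of the sets of objects. -/
def ColimitObj : Type u :=
  Quot fun x y : Σ j, (F.obj j).carrier =>
    ∃ f : x.1 ⟶ y.1, (toFunctor (F.map f)).obj x.2 = y.2

namespace ColimitObj

variable {F}

/-- The class of an object in the colimit. -/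
def mk (j : J) (x : (F.obj j).carrier) : ColimitObj F :=
  Quot.mk _ ⟨j, x⟩

theorem mk_map {i j : J} (f : i ⟶ j) (x : (F.obj i).carrier) :
    mk j ((toFunctor (F.map f)).obj x) = mk i x :=
  (Quot.sound ⟨f, rfl⟩).symm

theorem cocone_w (s : Cocone F) {i j : J} (f : i ⟶ j) :
    toFunctor (F.map f) ⋙ toFunctor (s.ι.app j) = toFunctor (s.ι.app i) := by
  rw [← toFunctor_comp, s.w]

/-- The action on objects of the functor out of the colimit induced by a cocone. -/
def desc (s : Cocone F) (X : ColimitObj F) : s.pt.carrier :=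
  Quot.lift (fun x => (toFunctor (s.ι.app x.1)).obj x.2) (fun x _ ⟨f, h⟩ =>
    (Functor.congr_obj (cocone_w s f) x.2).symm.trans
      (congrArg (toFunctor (s.ι.app _)).obj h)) X

/-- Formal expressions for the morphisms of the colimit. -/
inductive Pre : ColimitObj F → ColimitObj F → Type u
  | of {j : J} {x y : (F.obj j).carrier} (a : x ⟶ y) : Pre (mk j x) (mk j y)
  | id (X : ColimitObj F) : Pre X X
  | comp {X Y Z : ColimitObj F} (p : Pre X Y) (q : Pre Y Z) : Pre X Z
  | zero (X Y : ColimitObj F) : Pre X Y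
  | add {X Y : ColimitObj F} (p q : Pre X Y) : Pre X Y
  | smul {X Y : ColimitObj F} (r : ℂ) (p : Pre X Y) : Pre X Y
  | star {X Y : ColimitObj F} (p : Pre X Y) : Pre Y X

/-- The value of a formal expression in the point of a cocone. -/
def Pre.desc (s : Cocone F) : ∀ {X Y : ColimitObj F}, Pre X Y → (X.desc s ⟶ Y.desc s)
  | _, _, @Pre.of _ _ _ j _ _ a => (toFunctor (s.ι.app j)).map a
  | _, _, .id X => 𝟙 (X.desc s)
  | _, _, .comp p q => p.desc s ≫ q.desc s
  | _, _, .zero _ _ => 0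
  | _, _, .add p q => p.desc s + q.desc s
  | _, _, .smul r p => r • p.desc s
  | _, _, .star p => StarCategoryStruct.star (p.desc s)

/-- Two formal expressions are identified when they have the same value in every cocone. -/
instance preSetoid (X Y : ColimitObj F) : Setoid (Pre X Y) where
  r p q := ∀ s : Cocone F, p.desc s = q.desc s
  iseqv := ⟨fun _ _ => rfl, fun h s => (h s).symm, fun h k s => (h s).trans (k s)⟩

/-- The morphisms of the colimit of `F`. -/
def Hom (X Y : ColimitObj F) : Type u :=
  Quotient (preSetoid X Y)

namespace Hom

variable {X Y Z : ColimitObj F}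

/-- The value of a morphism of the colimit in the point of a cocone. -/
def desc (s : Cocone F) (f : Hom X Y) : X.desc s ⟶ Y.desc s :=
  Quotient.lift (fun p : Pre X Y => p.desc s) (fun _ _ (h : ∀ _, _) => h s) f

theorem ext {f g : Hom X Y} (h : ∀ s, f.desc s = g.desc s) : f = g := by
  induction f using Quotient.inductionOn
  induction g using Quotient.inductionOn
  exact Quotient.sound h

/-- The identity morphisms of the colimit. -/
def id (X : ColimitObj F) : Hom X X :=
  Quotient.mk _ (.id X)

/-- The composition of the colimit. -/
def comp (f : Hom X Y) (g : Hom Y Z) : Hom X Z :=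
  Quotient.map₂ Pre.comp
    (fun _ _ (h : ∀ _, _) _ _ (k : ∀ _, _) s => by simp only [Pre.desc, h s, k s]) f g

instance : Zero (Hom X Y) :=
  ⟨Quotient.mk _ (.zero X Y)⟩

instance : Add (Hom X Y) :=
  ⟨Quotient.map₂ Pre.add
    (fun _ _ (h : ∀ _, _) _ _ (k : ∀ _, _) s => by simp only [Pre.desc, h s, k s])⟩

instance : SMul ℂ (Hom X Y) :=
  ⟨fun r => Quotient.map (Pre.smul r) (fun _ _ (h : ∀ _, _) s => congrArg (fun a => r • a) (h s))⟩

instance : Neg (Hom X Y) :=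
  ⟨fun f => (-1 : ℂ) • f⟩

/-- The involution of the colimit. -/
def star (f : Hom X Y) : Hom Y X :=
  Quotient.map Pre.star (fun _ _ (h : ∀ _, _) s => congrArg StarCategoryStruct.star (h s)) f

variable (s : Cocone F)

@[simp]
theorem desc_id : (Hom.id X).desc s = 𝟙 (X.desc s) := rfl

@[simp]
theorem desc_comp (f : Hom X Y) (g : Hom Y Z) : (f.comp g).desc s = f.desc s ≫ g.desc s := by
  induction f using Quotient.inductionOn
  induction g using Quotient.inductionOn
  rfl

@[simp]
theorem desc_zero : (0 : Hom X Y).desc s = 0 := rfl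

@[simp]
theorem desc_add (f g : Hom X Y) : (f + g).desc s = f.desc s + g.desc s := by
  induction f using Quotient.inductionOn
  induction g using Quotient.inductionOn
  rfl

@[simp]
theorem desc_smul (r : ℂ) (f : Hom X Y) : (r • f).desc s = r • f.desc s := by
  induction f using Quotient.inductionOn
  rfl

@[simp]
theorem desc_neg (f : Hom X Y) : (-f).desc s = -f.desc s :=
  (desc_smul s (-1) f).trans (neg_one_smul ℂ _)

@[simp]
theorem desc_star (f : Hom X Y) : f.star.desc s = StarCategoryStruct.star (f.desc s) := by
  induction f using Quotient.inductionOn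
  rfl

instance : AddCommGroup (Hom X Y) where
  add_assoc f g h := ext fun s => by simp [add_assoc]
  zero_add f := ext fun s => by simp
  add_zero f := ext fun s => by simp
  neg_add_cancel f := ext fun s => by simp
  add_comm f g := ext fun s => by simp [add_comm]
  nsmul := nsmulRec
  zsmul := zsmulRec

instance : Module ℂ (Hom X Y) where
  one_smul f := ext fun s => by simp
  mul_smul r t f := ext fun s => by simp [mul_smul]
  smul_zero r := ext fun s => by simp
  smul_add r f g := ext fun s => by simp
  add_smul r t f := ext fun s => by simp [add_smul]
  zero_smul f := ext fun s => by simp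

end Hom

instance : SmallCategory (ColimitObj F) where
  Hom := Hom
  id := Hom.id
  comp := Hom.comp
  id_comp f := Hom.ext fun s => by simp
  comp_id f := Hom.ext fun s => by simp
  assoc f g h := Hom.ext fun s => by simp

instance : Preadditive (ColimitObj F) where
  homGroup X Y := inferInstanceAs (AddCommGroup (Hom X Y))
  add_comp X Y Z (f g : Hom X Y) (h : Hom Y Z) := Hom.ext fun s =>
    show ((f + g).comp h).desc s = (f.comp h + g.comp h).desc s by simp
  comp_add X Y Z (f : Hom X Y) (g h : Hom Y Z) := Hom.ext fun s =>
    show (f.comp (g + h)).desc s = (f.comp g + f.comp h).desc s by simp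

instance : Linear ℂ (ColimitObj F) where
  homModule X Y := inferInstanceAs (Module ℂ (Hom X Y))
  smul_comp X Y Z r (f : Hom X Y) (g : Hom Y Z) := Hom.ext fun s =>
    show ((r • f).comp g).desc s = (r • f.comp g).desc s by simp
  comp_smul X Y Z (f : Hom X Y) r (g : Hom Y Z) := Hom.ext fun s =>
    show (f.comp (r • g)).desc s = (r • f.comp g).desc s by simp

instance : StarLinearCategory (ColimitObj F) where
  star := Hom.star
  star_star f := Hom.ext fun s => by simp [StarCategoryStruct.star_star]
  star_id X := Hom.ext fun s =>
    show (Hom.id X).star.desc s = (Hom.id X).desc s by simp [star_id]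
  star_comp {X Y Z} (f : Hom X Y) (g : Hom Y Z) := Hom.ext fun s =>
    show (f.comp g).star.desc s = (g.star.comp f.star).desc s by
      simp [star_comp]
  star_add {X Y} (f g : Hom X Y) := Hom.ext fun s =>
    show (f + g).star.desc s = (f.star + g.star).desc s by
      simp [StarLinearCategory.star_add]
  star_smul {X Y} r (f : Hom X Y) := Hom.ext fun s =>
    show (r • f).star.desc s = (conj r • f.star).desc s by
      simp [StarLinearCategory.star_smul]

theorem hom_heq {X Y X' Y' : ColimitObj F} (hX : X = X') (hY : Y = Y') {f : Hom X Y}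
    {g : Hom X' Y'} (h : ∀ s, f.desc s ≍ g.desc s) : f ≍ g := by
  subst hX hY
  exact heq_of_eq (Hom.ext fun s => eq_of_heq (h s))

end ColimitObj

open ColimitObj

/-- The colimit cocone of `F`. -/
def colimitCocone : Cocone F where
  pt := ⟨ColimitObj F⟩
  ι :=
    { app j := ofFunctor (B := ⟨ColimitObj F⟩)
        { obj x := ColimitObj.mk j x
          map a := Quotient.mk _ (.of a)
          map_id x := Hom.ext fun s => (toFunctor (s.ι.app j)).map_id x
          map_comp a b := Hom.ext fun s => (toFunctor (s.ι.app j)).map_comp a b }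
        ⟨fun a => Hom.ext fun s => map_star (s.ι.app j) a,
          fun a b => Hom.ext fun s => map_add (s.ι.app j) a b,
          fun r a => Hom.ext fun s => map_smul (s.ι.app j) r a⟩
      naturality _ _ f := hom_ext <| Functor.hext (fun x => mk_map f x)
        fun x y a => hom_heq (mk_map f x) (mk_map f y)
          fun s => Functor.map_heq_of_eq (cocone_w s f) a }

/-- The functor out of the colimit induced by a cocone. -/
def colimitDesc (s : Cocone F) : (colimitCocone F).pt ⟶ s.pt :=
  ofFunctor (A := ⟨ColimitObj F⟩)
    { obj X := X.desc s
      map f := Hom.desc s f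
      map_id _ := rfl
      map_comp f g := Hom.desc_comp s f g }
    ⟨fun f => Hom.desc_star s f, fun f g => Hom.desc_add s f g, fun r f => Hom.desc_smul s r f⟩

/-- The cocone `colimitCocone F` is a colimit cocone. -/
def isColimitColimitCocone : IsColimit (colimitCocone F) where
  desc s := colimitDesc F s
  fac s j := rfl
  uniq s m hm := by
    have key (j : J) : toFunctor ((colimitCocone F).ι.app j) ⋙ toFunctor m =
        toFunctor (s.ι.app j) := by
      rw [← toFunctor_comp, hm]
    have hobj (X : ColimitObj F) : (toFunctor m).obj X = ColimitObj.desc s X := by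
      obtain ⟨j, x⟩ := X
      exact Functor.congr_obj (key j) x
    have hmap {X Y : ColimitObj F} (p : Pre X Y) :
        (toFunctor m).map (Quotient.mk _ p : Hom X Y) ≍ p.desc s := by
      induction p with
      | of a => exact Functor.map_heq_of_eq (key _) a
      | id X =>
        exact (heq_of_eq ((toFunctor m).map_id (X : ColimitObj F))).trans (heq_id (hobj X))
      | comp p q hp hq =>
        exact (heq_of_eq ((toFunctor m).map_comp _ _)).trans
          (heq_comp_of_heq (hobj _) (hobj _) (hobj _) hp hq)
      | zero X Y => exact (heq_of_eq (map_zero m X Y)).trans (heq_zero (hobj X) (hobj Y))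
      | add p q hp hq =>
        exact (heq_of_eq (map_add m _ _)).trans (heq_add (hobj _) (hobj _) hp hq)
      | smul r p hp =>
        exact (heq_of_eq (map_smul m r _)).trans (heq_smul (hobj _) (hobj _) r hp)
      | star p hp =>
        exact (heq_of_eq (map_star m _)).trans (heq_star (hobj _) (hobj _) hp)
    refine hom_ext <| Functor.hext hobj ?_
    rintro X Y ⟨p⟩
    exact hmap p

end CLinStarCat

open CategoryTheory.Limits in
/-- The category of small `ℂ`-linear `*`-categories is complete and cocomplete. -/
theorem cLinStarCat_hasLimits_hasColimits :
    HasLimits CLinStarCat.{u} ∧ HasColimits CLinStarCat.{u} := by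
  exact ⟨⟨fun _ _ => ⟨fun F => ⟨⟨⟨_, CLinStarCat.isLimitLimitCone F⟩⟩⟩⟩⟩,
    ⟨fun _ _ => ⟨fun F => ⟨⟨⟨_, CLinStarCat.isColimitColimitCocone F⟩⟩⟩⟩⟩⟩
end

section
/- Equivariant cofibrancy of D ♯ G̃: let G be a group with strict actions on *-categories A, B and D. Let f : A ⥤ B be an equivariant *-functor that is good and a unitary equivalence, and let u : D ♯ G̃ ⥤ B be an equivariant *-functor, where D ♯ G̃ carries the diagonal strict G-action. Then there exists an equivariant *-functor ℓ : D ♯ G̃ ⥤ A with ℓ ⋙ f = u (equality of functors). -/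
open CategoryTheory

universe v u

theorem groupoid_inv_id {G : Type*} [Groupoid G] (x : G) :
    Groupoid.inv (𝟙 x) = 𝟙 x := by
  simp [Groupoid.inv_eq_inv]

theorem groupoid_inv_comp' {G : Type*} [Groupoid G] {x y z : G} (f : x ⟶ y) (g : y ⟶ z) :
    Groupoid.inv (f ≫ g) = Groupoid.inv g ≫ Groupoid.inv f := by
  simp [Groupoid.inv_eq_inv]

theorem groupoid_inv_inv {G : Type*} [Groupoid G] {x y : G} (f : x ⟶ y) :
    Groupoid.inv (Groupoid.inv f) = f := by
  simp [Groupoid.inv_eq_inv]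

/-- For a `*`-category `C` and a groupoid `G`, the product `C ♯ G` is a `*`-category with
involution `(f, φ)* = (f*, φ⁻¹)`. -/
instance prodStarCategoryStruct (C : Type*) [Category C] [StarCategoryStruct C]
    (G : Type*) [Groupoid G] : StarCategoryStruct (C × G) where
  star f := (StarCategoryStruct.star f.1, Groupoid.inv f.2)
  star_star f := Prod.ext (StarCategoryStruct.star_star f.1) (groupoid_inv_inv f.2)
  star_id X := Prod.ext (StarCategoryStruct.star_id X.1) (groupoid_inv_id X.2)
  star_comp f g :=
    Prod.ext (StarCategoryStruct.star_comp f.1 g.1) (groupoid_inv_comp' f.2 g.2)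

/-- The chaotic (indiscrete) groupoid on a type: exactly one morphism between any two objects. -/
def Chaotic (G : Type u) : Type u := G

/-- Reinterpret an element as an object of the chaotic groupoid. -/
def Chaotic.mk {G : Type u} (g : G) : Chaotic G := g

/-- Reinterpret an object of the chaotic groupoid as an element. -/
def Chaotic.el {G : Type u} (g : Chaotic G) : G := g

instance {G : Type u} : Groupoid (Chaotic G) where
  Hom _ _ := PUnit
  id _ := PUnit.unit
  comp _ _ := PUnit.unit
  inv _ := PUnit.unit
  id_comp _ := rfl
  comp_id _ := rfl
  assoc _ _ _ := rfl
  inv_comp _ := rfl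
  comp_inv _ := rfl

/-- The left-translation functor on the chaotic groupoid of a group. -/
def leftTrans {G : Type u} [Group G] (g : G) : Chaotic G ⥤ Chaotic G where
  obj x := Chaotic.mk (g * x.el)
  map _ := PUnit.unit
  map_id _ := rfl
  map_comp _ _ := rfl

/-- A good unitary equivalence is surjective on objects. -/
theorem IsGood.obj_surjective {C D : Type*} [Category C] [Category D]
    [StarCategoryStruct C] [StarCategoryStruct D] {F : C ⥤ D} (hF : IsGood F)
    (hF' : IsUnitaryEquivalence F) : Function.Surjective F.obj := by
  obtain ⟨G, -, -, ε, -, hε⟩ := hF'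
  intro d
  obtain ⟨c, hc, -⟩ := hF (G.obj d) d (ε.hom.app d) (hε d)
  exact ⟨c, hc⟩

/-- Functors with the same objects that agree after composition with a faithful functor
are equal. -/
theorem functor_eq_of_comp_faithful_eq_s13 {X C D : Type*} [Category X] [Category C] [Category D]
    (F : C ⥤ D) [F.Faithful] {K L : X ⥤ C} (hobj : ∀ x, K.obj x = L.obj x)
    (h : K ⋙ F = L ⋙ F) : K = L := by
  refine CategoryTheory.Functor.ext hobj fun x y φ => F.map_injective ?_
  simpa [eqToHom_map] using Functor.congr_hom h φ

/-- A lift on objects of a functor along a fully faithful functor extends to a lift of the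
functor. -/
theorem exists_functor_lift_of_obj_lift {X C D : Type*} [Category X] [Category C] [Category D]
    (F : C ⥤ D) [F.Full] [F.Faithful] (U : X ⥤ D) (L : X → C)
    (hL : ∀ x, F.obj (L x) = U.obj x) :
    ∃ K : X ⥤ C, (∀ x, K.obj x = L x) ∧ K ⋙ F = U := by
  refine ⟨{ obj := L
            map := fun {x y} φ =>
              F.preimage (eqToHom (hL x) ≫ U.map φ ≫ eqToHom (hL y).symm)
            map_id := fun x => F.map_injective (by simp)
            map_comp := fun φ ψ => F.map_injective (by simp) }, fun _ => rfl, ?_⟩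
  exact CategoryTheory.Functor.ext hL fun x y φ => by simp

theorem IsStarFunctor.of_comp_faithful {X C D : Type*} [Category X] [Category C] [Category D]
    [StarCategoryStruct X] [StarCategoryStruct C] [StarCategoryStruct D]
    {K : X ⥤ C} {F : C ⥤ D} [F.Faithful] (hF : IsStarFunctor F)
    (hKF : IsStarFunctor (K ⋙ F)) : IsStarFunctor K := fun φ =>
  F.map_injective ((hKF φ).trans (hF (K.map φ)).symm)

/-- Equivariant cofibrancy of `D ♯ G̃`: every equivariant `*`-functor `D ♯ G̃ ⥤ B` lifts along
an equivariant good unitary equivalence `f : A ⥤ B` to an equivariant `*`-functor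
`D ♯ G̃ ⥤ A`. -/
theorem equivariant_lift_along_trivialFibration
    {G : Type u} [Group G]
    {A B D : Type*} [Category A] [Category B] [Category D]
    [StarCategoryStruct A] [StarCategoryStruct B] [StarCategoryStruct D]
    (ρA : G → (A ⥤ A)) (hA1 : ρA 1 = 𝟭 A)
    (hAmul : ∀ g h : G, ρA g ⋙ ρA h = ρA (h * g))
    (hAstar : ∀ g : G, IsStarFunctor (ρA g))
    (ρB : G → (B ⥤ B)) (hB1 : ρB 1 = 𝟭 B)
    (hBmul : ∀ g h : G, ρB g ⋙ ρB h = ρB (h * g))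
    (hBstar : ∀ g : G, IsStarFunctor (ρB g))
    (ρD : G → (D ⥤ D)) (hD1 : ρD 1 = 𝟭 D)
    (hDmul : ∀ g h : G, ρD g ⋙ ρD h = ρD (h * g))
    (hDstar : ∀ g : G, IsStarFunctor (ρD g))
    (f : A ⥤ B) (hfstar : IsStarFunctor f)
    (hfgood : IsGood f) (hfequiv : IsUnitaryEquivalence f)
    (hfequivariant : ∀ g : G, ρA g ⋙ f = f ⋙ ρB g)
    (u : (D × Chaotic G) ⥤ B) (hustar : IsStarFunctor u)
    (huequivariant : ∀ g : G, (ρD g).prod (leftTrans g) ⋙ u = u ⋙ ρB g) :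
    ∃ ℓ : (D × Chaotic G) ⥤ A, IsStarFunctor ℓ ∧
      (∀ g : G, (ρD g).prod (leftTrans g) ⋙ ℓ = ℓ ⋙ ρA g) ∧
      ℓ ⋙ f = u := by
  have := hfequiv.isEquivalence
  choose a ha using fun d : D => hfgood.obj_surjective hfequiv (u.obj (d, Chaotic.mk 1))
  have hf_obj (g : G) (x : A) : f.obj ((ρA g).obj x) = (ρB g).obj (f.obj x) :=
    Functor.congr_obj (hfequivariant g) x
  have hu_obj (g : G) (d : D) (k : G) : u.obj ((ρD g).obj d, Chaotic.mk (g * k)) =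
      (ρB g).obj (u.obj (d, Chaotic.mk k)) :=
    Functor.congr_obj (huequivariant g) (d, Chaotic.mk k)
  have hA_obj (g h : G) (x : A) : (ρA h).obj ((ρA g).obj x) = (ρA (h * g)).obj x :=
    Functor.congr_obj (hAmul g h) x
  have hD_obj (g h : G) (d : D) : (ρD h).obj ((ρD g).obj d) = (ρD (h * g)).obj d :=
    Functor.congr_obj (hDmul g h) d
  obtain ⟨ℓ, hℓ_obj, hℓ⟩ := exists_functor_lift_of_obj_lift f u
    (fun x => (ρA x.2.el).obj (a ((ρD x.2.el⁻¹).obj x.1))) (by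
      rintro ⟨d, g⟩
      change f.obj ((ρA g.el).obj (a ((ρD g.el⁻¹).obj d))) = u.obj (d, Chaotic.mk g.el)
      rw [hf_obj, ha, ← hu_obj, hD_obj, mul_inv_cancel, hD1, mul_one]
      rfl)
  refine ⟨ℓ, hfstar.of_comp_faithful (by rwa [hℓ]), fun g => ?_, hℓ⟩
  refine functor_eq_of_comp_faithful_eq_s13 f ?_ ?_
  · rintro ⟨d, k⟩
    change ℓ.obj ((ρD g).obj d, Chaotic.mk (g * k.el)) = (ρA g).obj (ℓ.obj (d, k))
    rw [hℓ_obj, hℓ_obj, hA_obj]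
    change (ρA (g * k.el)).obj (a ((ρD (g * k.el)⁻¹).obj ((ρD g).obj d))) = _
    rw [hD_obj, mul_inv_rev, inv_mul_cancel_right]
  · rw [Functor.assoc, Functor.assoc, hfequivariant, ← Functor.assoc ℓ, hℓ, huequivariant]
end

section
/- Strong generator criterion: let C be a category and 𝒢 a set of objects of C. Suppose every object X of C is the apex of a colimit cocone over some small diagram all of whose values lie in 𝒢. Then: (1) 𝒢 is a separating set, i.e. for every parallel pair f, g : X ⟶ Y with f ≠ g there exist G ∈ 𝒢 and h : G ⟶ X with h ≫ f ≠ h ≫ g; and (2) for every monomorphism m : D ⟶ X that is not an isomorphism there exist G ∈ 𝒢 and h : G ⟶ X that does not factor through m. -/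
open CategoryTheory CategoryTheory.Limits

universe w v u

/-- A monomorphism through which every leg of a colimit cocone factors is an isomorphism. -/
theorem isIso_of_isColimit_of_factors {C : Type u} [Category.{v} C] {I : Type*} [Category* I]
    {B : I ⥤ C} {c : Cocone B} (hc : IsColimit c) {D : C} (m : D ⟶ c.pt) [Mono m]
    (h : ∀ i, ∃ k : B.obj i ⟶ D, k ≫ m = c.ι.app i) : IsIso m := by
  choose k hk using h
  let d : Cocone B :=
    { pt := D
      ι :=
        { app := k
          naturality := fun i j f => by
            rw [← cancel_mono m]
            simp [hk] } }
  have hs : hc.desc d ≫ m = 𝟙 c.pt := hc.hom_ext fun i => by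
    rw [hc.fac_assoc, Category.comp_id]
    exact hk i
  exact ⟨hc.desc d, by rw [← cancel_mono m, Category.assoc, hs, Category.comp_id, Category.id_comp],
    hs⟩

/-- Strong generator criterion: if every object of `C` is the apex of a colimit cocone over a
small diagram with values in `𝒢`, then `𝒢` is a separating set and detects proper subobjects. -/
theorem strong_generator_of_colimits {C : Type u} [Category.{v} C] (𝒢 : Set C)
    (hgen : ∀ X : C, ∃ (I : Cat.{w, w}) (B : I ⥤ C) (c : Cocone B),
      (∀ i : I, B.obj i ∈ 𝒢) ∧ Nonempty (IsColimit c) ∧ c.pt = X) :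
    (∀ (X Y : C) (f g : X ⟶ Y), f ≠ g →
      ∃ G ∈ 𝒢, ∃ h : G ⟶ X, h ≫ f ≠ h ≫ g) ∧
    (∀ (D X : C) (m : D ⟶ X), Mono m → ¬IsIso m →
      ∃ G ∈ 𝒢, ∃ h : G ⟶ X, ¬∃ k : G ⟶ D, k ≫ m = h) := by
  constructor
  · intro X Y f g hfg
    obtain ⟨I, B, c, hB, ⟨hc⟩, rfl⟩ := hgen X
    by_contra! h
    exact hfg (hc.hom_ext fun i => h _ (hB i) (c.ι.app i))
  · intro D X m hm hiso
    obtain ⟨I, B, c, hB, ⟨hc⟩, rfl⟩ := hgen X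
    by_contra! h
    exact hiso (isIso_of_isColimit_of_factors hc m fun i => h _ (hB i) (c.ι.app i))
end

section
/- Unitary equivalences preserve the maximal norm: let A and B be small ℂ-linear *-categories and Φ : A ⥤ B a ℂ-linear *-functor that is a unitary equivalence (i.e. there exist a ℂ-linear *-functor Ψ : B ⥤ A and natural isomorphisms Φ ⋙ Ψ ≅ 𝟭 A and Ψ ⋙ Φ ≅ 𝟭 B with unitary components). Then for every morphism f of A one has ‖Φ.map f‖_max = ‖f‖_max, where both maximal norms are computed with respect to representations into C*-algebras in a common fixed universe. -/
open CategoryTheory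

universe w v u

open scoped ComplexConjugate

/-- A representation of a `ℂ`-linear `*`-category in a (non-unital) C*-algebra `B`: a map on
morphisms that is `ℂ`-linear on hom-spaces, sends composition to (reversed) multiplication and
intertwines the involutions. -/
structure StarRepresentation (C : Type u) [Category.{v} C] [Preadditive C] [Linear ℂ C]
    [StarLinearCategory C] (B : Type w) [NonUnitalCStarAlgebra B] where
  toFun : ∀ {X Y : C}, (X ⟶ Y) → B
  map_add : ∀ {X Y : C} (f g : X ⟶ Y), toFun (f + g) = toFun f + toFun g
  map_smul : ∀ {X Y : C} (a : ℂ) (f : X ⟶ Y), toFun (a • f) = a • toFun f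
  map_comp : ∀ {X Y Z : C} (f : X ⟶ Y) (g : Y ⟶ Z), toFun (f ≫ g) = toFun g * toFun f
  map_star : ∀ {X Y : C} (f : X ⟶ Y),
    toFun (StarCategoryStruct.star f) = star (toFun f)

/-- A bundled C*-algebra in the universe `w`. -/
structure CStarAlgebraBundle : Type (w + 1) where
  carrier : Type w
  [inst : NonUnitalCStarAlgebra carrier]

attribute [instance] CStarAlgebraBundle.inst

/-- The maximal norm of a morphism of a `ℂ`-linear `*`-category: the supremum, in `[0, ∞]`, of
the norms of its images under all representations in C*-algebras of the universe `w`. -/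
noncomputable def maxNorm {C : Type u} [Category.{v} C] [Preadditive C] [Linear ℂ C]
    [StarLinearCategory C] {X Y : C} (f : X ⟶ Y) : ENNReal :=
  ⨆ (B : CStarAlgebraBundle.{w}) (ρ : StarRepresentation C B.carrier),
    (‖ρ.toFun f‖₊ : ENNReal)

namespace StarRepresentation

variable {C : Type*} [Category C] [Preadditive C] [Linear ℂ C] [StarLinearCategory C]
  {D : Type*} [Category D] [Preadditive D] [Linear ℂ D] [StarLinearCategory D]
  {R : Type*} [NonUnitalCStarAlgebra R]

/-- The pullback of a representation along a `ℂ`-linear `*`-functor. -/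
def pullback (ρ : StarRepresentation D R) (F : C ⥤ D) (hF : IsLinearStarFunctor F) :
    StarRepresentation C R where
  toFun f := ρ.toFun (F.map f)
  map_add f g := by rw [hF.2.1, ρ.map_add]
  map_smul a f := by rw [hF.2.2, ρ.map_smul]
  map_comp f g := by rw [F.map_comp, ρ.map_comp]
  map_star f := by rw [hF.1, ρ.map_star]

theorem norm_map_star (ρ : StarRepresentation C R) {X Y : C} (f : X ⟶ Y) :
    ‖ρ.toFun (StarCategoryStruct.star f)‖ = ‖ρ.toFun f‖ := by
  rw [ρ.map_star, norm_star]

theorem norm_map_star_comp_self (ρ : StarRepresentation C R) {X Y : C} (f : X ⟶ Y) :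
    ‖ρ.toFun (f ≫ StarCategoryStruct.star f)‖ = ‖ρ.toFun f‖ * ‖ρ.toFun f‖ := by
  rw [ρ.map_comp, ρ.map_star, CStarRing.norm_star_mul_self]

theorem norm_map_id_le_one (ρ : StarRepresentation C R) (X : C) : ‖ρ.toFun (𝟙 X)‖ ≤ 1 := by
  have h := ρ.norm_map_star_comp_self (𝟙 X)
  rw [StarCategoryStruct.star_id, Category.comp_id] at h
  nlinarith [norm_nonneg (ρ.toFun (𝟙 X))]

theorem norm_map_le_one_of_isUnitary (ρ : StarRepresentation C R) {X Y : C} {u : X ⟶ Y}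
    (hu : IsUnitary u) : ‖ρ.toFun u‖ ≤ 1 := by
  have h := ρ.norm_map_star_comp_self u
  rw [hu.1] at h
  nlinarith [ρ.norm_map_id_le_one X, norm_nonneg (ρ.toFun u)]

theorem norm_map_star_comp_comp_le (ρ : StarRepresentation C R) {X X' Y Y' : C}
    {u : X' ⟶ X} {v : Y' ⟶ Y} (hu : IsUnitary u) (hv : IsUnitary v) (g : X' ⟶ Y') :
    ‖ρ.toFun (StarCategoryStruct.star u ≫ g ≫ v)‖ ≤ ‖ρ.toFun g‖ := by
  rw [ρ.map_comp, ρ.map_comp]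
  calc ‖ρ.toFun v * ρ.toFun g * ρ.toFun (StarCategoryStruct.star u)‖
      ≤ ‖ρ.toFun v‖ * ‖ρ.toFun g‖ * ‖ρ.toFun (StarCategoryStruct.star u)‖ :=
        (norm_mul_le _ _).trans (by gcongr; exact norm_mul_le _ _)
    _ ≤ 1 * ‖ρ.toFun g‖ * 1 := by
        rw [ρ.norm_map_star]
        gcongr
        exacts [ρ.norm_map_le_one_of_isUnitary hv, ρ.norm_map_le_one_of_isUnitary hu]
    _ = ‖ρ.toFun g‖ := by rw [one_mul, mul_one]

end StarRepresentation

section MaxNorm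

variable {C : Type*} [Category C] [Preadditive C] [Linear ℂ C] [StarLinearCategory C]
  {D : Type*} [Category D] [Preadditive D] [Linear ℂ D] [StarLinearCategory D]

/-- `ℂ`-linear `*`-functors do not increase the maximal norm. -/
theorem maxNorm_map_le (F : C ⥤ D) (hF : IsLinearStarFunctor F) {X Y : C} (f : X ⟶ Y) :
    maxNorm.{w} (F.map f) ≤ maxNorm.{w} f :=
  iSup_mono fun _ => iSup_le fun ρ =>
    le_iSup_of_le (ρ.pullback F hF) le_rfl

/-- Composing with unitaries on both sides does not increase the maximal norm. -/
theorem maxNorm_star_comp_comp_le {X X' Y Y' : C} {u : X' ⟶ X} {v : Y' ⟶ Y}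
    (hu : IsUnitary u) (hv : IsUnitary v) (g : X' ⟶ Y') :
    maxNorm.{w} (StarCategoryStruct.star u ≫ g ≫ v) ≤ maxNorm.{w} g :=
  iSup_mono fun _ => iSup_mono fun ρ =>
    ENNReal.coe_le_coe.2 (ρ.norm_map_star_comp_comp_le hu hv g)

end MaxNorm

/-- Unitary equivalences of `ℂ`-linear `*`-categories preserve the maximal norm. -/
theorem maxNorm_map_eq_of_unitaryEquivalence
    {A B : Type u} [SmallCategory A] [SmallCategory B]
    [Preadditive A] [Preadditive B] [Linear ℂ A] [Linear ℂ B]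
    [StarLinearCategory A] [StarLinearCategory B]
    (Φ : A ⥤ B) (hΦ : IsLinearStarFunctor Φ)
    (hequiv : ∃ Ψ : B ⥤ A, IsLinearStarFunctor Ψ ∧
      ∃ (η : Φ ⋙ Ψ ≅ 𝟭 A) (ε : Ψ ⋙ Φ ≅ 𝟭 B),
        (∀ X : A, IsUnitary (η.hom.app X)) ∧ (∀ Y : B, IsUnitary (ε.hom.app Y))) :
    ∀ {X Y : A} (f : X ⟶ Y), maxNorm.{w} (Φ.map f) = maxNorm.{w} f := by
  obtain ⟨Ψ, hΨ, η, -, hη, -⟩ := hequiv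
  intro X Y f
  refine le_antisymm (maxNorm_map_le Φ hΦ f) ?_
  have hf : StarCategoryStruct.star (η.hom.app X) ≫ Ψ.map (Φ.map f) ≫ η.hom.app Y = f := by
    have hnat : Ψ.map (Φ.map f) ≫ η.hom.app Y = η.hom.app X ≫ f := η.hom.naturality f
    rw [hnat, ← Category.assoc, (hη X).2]
    exact Category.id_comp f
  calc maxNorm.{w} f
      = maxNorm.{w} (StarCategoryStruct.star (η.hom.app X) ≫
          Ψ.map (Φ.map f) ≫ η.hom.app Y) := by rw [hf]
    _ ≤ maxNorm.{w} (Ψ.map (Φ.map f)) := maxNorm_star_comp_comp_le (hη X) (hη Y) _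
    _ ≤ maxNorm.{w} (Φ.map f) := maxNorm_map_le Ψ hΨ _
end
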